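/- arXiv:2404.00222 — 2 statements merged into one kernel-verified Lean document; each statement's English description precedes it below -/
import Mathlib

section
/- Let q = p^k be an odd prime power. A function f : F_q → F_q is a sign preserver on M_2(F_q) if and only if f is a positive multiple of a field automorphism of F_q, i.e., there exist c ∈ F_q^+ and an integer ℓ with 0 ≤ ℓ ≤ k−1 such that f(x) = c·x^{p^ℓ} for all x ∈ F_q. -/
/-- An element of a field is *positive* if it is a nonzero square. -/
def IsPos {F : Type*} [Field F] (x : F) : Prop := ∃ y : F, y ≠ 0 ∧ y ^ 2 = x

/-- The `r`-th leading principal minor of a square matrix (the determinant of the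
top-left `(r+1) × (r+1)` submatrix). -/
def leadingMinor {F : Type*} [CommRing F] {n : ℕ} (A : Matrix (Fin n) (Fin n) F)
    (r : Fin n) : F :=
  (A.submatrix (Fin.castLE r.isLt) (Fin.castLE r.isLt)).det

/-- A matrix over a finite field is positive definite if it is symmetric and all its
leading principal minors are positive (nonzero squares). -/
def IsPosDef {F : Type*} [Field F] {n : ℕ} (A : Matrix (Fin n) (Fin n) F) : Prop :=
  A.IsSymm ∧ ∀ r : Fin n, IsPos (leadingMinor A r)

/-- The entrywise application `f[A]` of `f` to the matrix `A`. -/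
def entrywiseMap {F : Type*} {n : ℕ} (f : F → F) (A : Matrix (Fin n) (Fin n) F) :
    Matrix (Fin n) (Fin n) F := Matrix.of fun i j => f (A i j)

/-- `f` preserves positivity on `n × n` matrices. -/
def PreservesPos {F : Type*} [Field F] (n : ℕ) (f : F → F) : Prop :=
  ∀ A : Matrix (Fin n) (Fin n) F, IsPosDef A → IsPosDef (entrywiseMap f A)

/-- `f` is a sign preserver on `M_n(F)`: for every symmetric `A`, `A` is positive
definite iff `f[A]` is positive definite. -/
def SignPreserver {F : Type*} [Field F] (n : ℕ) (f : F → F) : Prop :=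
  ∀ A : Matrix (Fin n) (Fin n) F, A.IsSymm → (IsPosDef A ↔ IsPosDef (entrywiseMap f A))

section IsPos

variable {F : Type*} [Field F]

theorem isPos_iff {x : F} : IsPos x ↔ x ≠ 0 ∧ IsSquare x := by
  constructor
  · rintro ⟨y, hy, rfl⟩
    exact ⟨pow_ne_zero _ hy, y, sq y⟩
  · rintro ⟨hx, y, rfl⟩
    exact ⟨y, fun h => hx (by simp [h]), sq y⟩

theorem IsPos.ne_zero {x : F} (hx : IsPos x) : x ≠ 0 := (isPos_iff.1 hx).1

theorem not_isPos_zero : ¬ IsPos (0 : F) := fun h => h.ne_zero rfl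

theorem isPos_one : IsPos (1 : F) := ⟨1, one_ne_zero, one_pow 2⟩

theorem IsPos.mul {x y : F} (hx : IsPos x) (hy : IsPos y) : IsPos (x * y) := by
  obtain ⟨s, hs, rfl⟩ := hx
  obtain ⟨t, ht, rfl⟩ := hy
  exact ⟨s * t, mul_ne_zero hs ht, mul_pow s t 2⟩

theorem IsPos.inv {x : F} (hx : IsPos x) : IsPos x⁻¹ := by
  obtain ⟨s, hs, rfl⟩ := hx
  exact ⟨s⁻¹, inv_ne_zero hs, inv_pow s 2⟩

theorem IsPos.mul_iff {x y : F} (hx : IsPos x) : IsPos (x * y) ↔ IsPos y :=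
  ⟨fun h => by simpa [hx.ne_zero] using hx.inv.mul h, hx.mul⟩

theorem isPos_sq_mul_iff {s y : F} (hs : s ≠ 0) : IsPos (s ^ 2 * y) ↔ IsPos y :=
  IsPos.mul_iff ⟨s, hs, rfl⟩

/-- Ring automorphisms preserve and reflect positivity. -/
theorem isPos_map_iff (φ : F ≃+* F) {x : F} : IsPos (φ x) ↔ IsPos x := by
  constructor
  · rintro ⟨y, hy, h⟩
    refine ⟨φ.symm y, by simpa using hy, φ.injective (by simpa using h)⟩
  · rintro ⟨y, hy, rfl⟩
    exact ⟨φ y, by simpa using hy, (map_pow φ y 2).symm⟩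

theorem isPosDef_two_iff {A : Matrix (Fin 2) (Fin 2) F} :
    IsPosDef A ↔ A.IsSymm ∧ IsPos (A 0 0) ∧ IsPos (A 0 0 * A 1 1 - A 0 1 * A 1 0) := by
  have h0 : leadingMinor A 0 = A 0 0 := by
    simp only [leadingMinor]
    exact Matrix.det_fin_one _
  have h1 : leadingMinor A 1 = A 0 0 * A 1 1 - A 0 1 * A 1 0 := by
    simp only [leadingMinor]
    exact Matrix.det_fin_two _
  rw [IsPosDef, Fin.forall_fin_two, h0, h1]

theorem signPreserver_two_iff {f : F → F} :
    SignPreserver 2 f ↔ ∀ a b c : F, (IsPos a ∧ IsPos (a * c - b ^ 2)) ↔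
      (IsPos (f a) ∧ IsPos (f a * f c - f b ^ 2)) := by
  constructor
  · intro h a b c
    have hs : (!![a, b; b, c] : Matrix (Fin 2) (Fin 2) F).IsSymm := by
      ext i j; fin_cases i <;> fin_cases j <;> rfl
    have hs' : (entrywiseMap f !![a, b; b, c]).IsSymm := by
      ext i j; fin_cases i <;> fin_cases j <;> rfl
    have := h _ hs
    simp only [isPosDef_two_iff, hs, hs', true_and] at this
    simpa [entrywiseMap, ← sq] using this
  · intro h A hA
    have hs' : (entrywiseMap f A).IsSymm := by
      ext i j
      simp [entrywiseMap, hA.apply i j]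
    have h10 : A 1 0 = A 0 1 := hA.apply 0 1
    simp only [isPosDef_two_iff, hA, hs', true_and]
    simpa [entrywiseMap, h10, ← sq] using h (A 0 0) (A 0 1) (A 1 1)

theorem signPreserver_two_mul_map {c : F} (hc : IsPos c) (φ : F ≃+* F) :
    SignPreserver 2 fun x => c * φ x := by
  rw [signPreserver_two_iff]
  intro x y z
  have h : c * φ x * (c * φ z) - (c * φ y) ^ 2 = c ^ 2 * φ (x * z - y ^ 2) := by
    simp only [map_sub, map_mul, map_pow]; ring
  rw [h, hc.mul_iff, isPos_sq_mul_iff hc.ne_zero, isPos_map_iff, isPos_map_iff]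

end IsPos

section Squares

variable {F : Type*} [Field F] [Fintype F]

theorem isPos_iff_pow_eq_one (hF : ringChar F ≠ 2) {x : F} :
    IsPos x ↔ x ^ (Fintype.card F / 2) = 1 := by
  have h2 : Fintype.card F / 2 ≠ 0 := by
    have := FiniteField.odd_card_of_char_ne_two hF
    have := Fintype.one_lt_card (α := F)
    omega
  rcases eq_or_ne x 0 with rfl | hx
  · simp [not_isPos_zero, h2]
  · rw [isPos_iff, FiniteField.isSquare_iff hF hx]
    simp [hx]

theorem pow_eq_pow_of_isPos_iff (hF : ringChar F ≠ 2) {x y : F} (hx : x = 0 ↔ y = 0)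
    (h : IsPos x ↔ IsPos y) :
    x ^ (Fintype.card F / 2) = y ^ (Fintype.card F / 2) := by
  rcases eq_or_ne x 0 with rfl | hx0
  · rw [hx.1 rfl]
  · have hy0 : y ≠ 0 := fun h' => hx0 (hx.2 h')
    rw [isPos_iff_pow_eq_one hF, isPos_iff_pow_eq_one hF] at h
    rcases FiniteField.pow_dichotomy hF hx0 with h1 | h1
    · rw [h1, h.1 h1]
    · rcases FiniteField.pow_dichotomy hF hy0 with h2 | h2
      · rw [h2, h.2 h2]
      · rw [h1, h2]

theorem isPos_mul_of_not_isPos (hF : ringChar F ≠ 2) {x y : F} (hx0 : x ≠ 0) (hy0 : y ≠ 0)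
    (hx : ¬ IsPos x) (hy : ¬ IsPos y) : IsPos (x * y) := by
  rw [isPos_iff_pow_eq_one hF] at *
  rw [mul_pow, (FiniteField.pow_dichotomy hF hx0).resolve_left hx,
    (FiniteField.pow_dichotomy hF hy0).resolve_left hy]
  simp

/-- The set of positive elements has no nontrivial translation symmetry. -/
theorem eq_of_isPos_sub_iff (hF : ringChar F ≠ 2) {d e : F}
    (h : ∀ x, IsPos (x - d) ↔ IsPos (x - e)) : d = e := by
  classical
  have hodd := FiniteField.odd_card_of_char_ne_two hF
  have hlt := Fintype.one_lt_card (α := F)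
  let w : F → F := fun x => x ^ (Fintype.card F - 1) + x ^ (Fintype.card F / 2)
  have hsum : ∑ x, w x = -1 := by
    have h1 : ∑ x : F, x ^ (Fintype.card F / 2) = 0 :=
      FiniteField.sum_pow_lt_card_sub_one F _ (by omega)
    have h2 : ∑ x : F, x ^ (Fintype.card F - 1) = -1 := by
      have : ∀ x : F, x ^ (Fintype.card F - 1) = 1 - if x = 0 then 1 else 0 := by
        intro x
        split_ifs with hx
        · rw [hx, zero_pow (by omega), sub_self]
        · rw [FiniteField.pow_card_sub_one_eq_one x hx, sub_zero]
      simp [this, Finset.sum_sub_distrib]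
    simp only [w, Finset.sum_add_distrib, h1, h2, add_zero]
  have hw : ∀ x, w x = if IsPos x then 2 else 0 := by
    intro x
    rcases eq_or_ne x 0 with rfl | hx
    · have h1 : Fintype.card F - 1 ≠ 0 := by omega
      have h2 : Fintype.card F / 2 ≠ 0 := by omega
      simp [w, not_isPos_zero, h1, h2]
    · simp only [w, FiniteField.pow_card_sub_one_eq_one x hx, isPos_iff_pow_eq_one hF]
      split_ifs with h1
      · rw [h1]; norm_num
      · rw [(FiniteField.pow_dichotomy hF hx).resolve_left h1]; ring
  have key : ∀ d : F, ∑ x, w (x - d) * x = ∑ x, w x * x - d := by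
    intro d
    rw [← Equiv.sum_comp (Equiv.addRight d)]
    simp [mul_add, Finset.sum_add_distrib, ← Finset.sum_mul, hsum, sub_eq_add_neg]
  have hde := key e
  have : ∀ x, w (x - e) = w (x - d) := fun x => by rw [hw, hw]; simp only [h x]
  simp only [this, key d] at hde
  exact sub_right_injective hde

open Polynomial in
/-- A nonsquare is determined by which of its translates by squares are positive. -/
theorem eq_of_isPos_sub_sq_iff (hF : ringChar F ≠ 2) {u v : F} (hu0 : u ≠ 0) (hv0 : v ≠ 0)
    (hu : ¬ IsPos u) (hv : ¬ IsPos v) (h : ∀ t, IsPos (u - t ^ 2) ↔ IsPos (v - t ^ 2)) :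
    u = v := by
  have hodd := FiniteField.odd_card_of_char_ne_two hF
  have hlt := Fintype.one_lt_card (α := F)
  have hne : ∀ w : F, w ≠ 0 → ¬ IsPos w → ∀ t, w - t ^ 2 ≠ 0 := by
    intro w hw0 hw t ht
    exact hw (isPos_iff.2 ⟨hw0, t, by rw [← sq]; exact sub_eq_zero.1 ht⟩)
  set m := Fintype.card F / 2 with hm
  let P : F[X] := (C u - X) ^ m - (C v - X) ^ m
  have hdeg : P.natDegree ≤ m := by
    have h1 : ∀ w : F, ((C w - X) ^ m : F[X]).natDegree ≤ m := by
      intro w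
      refine natDegree_pow_le.trans ?_
      have : (C w - X : F[X]).natDegree ≤ 1 :=
        (natDegree_sub_le _ _).trans (by simp)
      nlinarith
    exact (natDegree_sub_le _ _).trans (max_le (h1 u) (h1 v))
  have hP : P = 0 := by
    rw [← expand_eq_zero (p := 2) two_pos]
    refine eq_zero_of_natDegree_lt_card_of_eval_eq_zero _ Function.injective_id (fun t => ?_) ?_
    · have := pow_eq_pow_of_isPos_iff hF (x := u - t ^ 2) (y := v - t ^ 2)
        (by simp [hne u hu0 hu, hne v hv0 hv]) (h t)
      simp [P, this, m]
    · rw [natDegree_expand]; omega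
  have := congrArg (eval u) hP
  have hm0 : m ≠ 0 := by omega
  simp [P, hm0] at this
  exact (sub_eq_zero.1 this).symm

end Squares

section Normalized

variable {F : Type*} [Field F] [Fintype F] {f : F → F}

theorem injective_of_isPos_iff (hF : ringChar F ≠ 2) (h1 : f 1 = 1)
    (h : ∀ a b c : F, (IsPos a ∧ IsPos (a * c - b ^ 2)) ↔
      (IsPos (f a) ∧ IsPos (f a * f c - f b ^ 2))) : Function.Injective f := by
  intro u v huv
  have hone : ∀ b c : F, IsPos (c - b ^ 2) ↔ IsPos (f c - f b ^ 2) := by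
    intro b c
    simpa [h1, isPos_one] using h 1 b c
  have hleft : ∀ b c : F, (IsPos u ∧ IsPos (u * c - b ^ 2)) ↔
      (IsPos v ∧ IsPos (v * c - b ^ 2)) := by
    intro b c
    rw [h, huv, ← h]
  have hpos : IsPos u ↔ IsPos v := by
    have := hleft 0 1
    simpa using this
  have hsq : u ^ 2 = v ^ 2 := by
    refine eq_of_isPos_sub_iff hF fun c => ?_
    rw [hone, huv, ← hone]
  rcases sq_eq_sq_iff_eq_or_eq_neg.1 hsq with huv' | huv'
  · exact huv'
  rcases eq_or_ne v 0 with hv0 | hv0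
  · rw [huv', hv0, neg_zero]
  have hu0 : u ≠ 0 := by rw [huv']; exact neg_ne_zero.2 hv0
  by_cases hv : IsPos v
  · exfalso
    have hu := hpos.2 hv
    have hneg : IsPos (-1 : F) := by
      have : (-1 : F) = u * v⁻¹ := by rw [huv']; field_simp
      rw [this]
      exact hu.mul hv.inv
    have : (1 : F) = -1 := by
      refine eq_of_isPos_sub_iff hF fun x => ?_
      have := hleft 1 (x / u)
      rw [mul_div_cancel₀ _ hu0, show v * (x / u) - 1 ^ 2 = -1 * (x - -1) by
        rw [huv']; field_simp; ring, hneg.mul_iff] at this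
      simpa [hu, hv] using this
    exact Ring.neg_one_ne_one_of_char_ne_two hF this.symm
  · refine eq_of_isPos_sub_sq_iff hF hu0 hv0 (mt hpos.1 hv) hv fun t => ?_
    rw [hone, huv, ← hone]

/-- A sign preserver fixing `1` is multiplicative. -/
theorem map_mul_of_isPos_iff (hF : ringChar F ≠ 2) (h1 : f 1 = 1)
    (h : ∀ a b c : F, (IsPos a ∧ IsPos (a * c - b ^ 2)) ↔
      (IsPos (f a) ∧ IsPos (f a * f c - f b ^ 2))) :
    f 0 = 0 ∧ ∀ x y, f (x * y) = f x * f y := by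
  have hinj := injective_of_isPos_iff hF h1 h
  have hsurj : Function.Surjective f := Finite.surjective_of_injective hinj
  have hone : ∀ b c : F, IsPos (c - b ^ 2) ↔ IsPos (f c - f b ^ 2) := by
    intro b c
    simpa [h1, isPos_one] using h 1 b c
  have hpos : ∀ x, IsPos x ↔ IsPos (f x) := by
    intro x
    constructor
    · intro hx
      exact ((h x 0 1).1 ⟨hx, by simpa using hx⟩).1
    · intro hx
      obtain ⟨c, hc⟩ := hsurj ((1 + f 0 ^ 2) / f x)
      refine ((h x 0 c).2 ⟨hx, ?_⟩).1
      rw [hc, mul_div_cancel₀ _ hx.ne_zero]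
      simpa using isPos_one
  have h0 : f 0 = 0 := by
    have : f 0 ^ 2 = 0 := by
      refine eq_of_isPos_sub_iff hF fun x => ?_
      obtain ⟨c, rfl⟩ := hsurj x
      rw [← hone, sub_zero, ← hpos]
      simp
    exact pow_eq_zero_iff two_ne_zero |>.1 this
  have hsub : ∀ a b c, IsPos a → (IsPos (a * c - b ^ 2) ↔ IsPos (f a * f c - f b ^ 2)) := by
    intro a b c ha
    simpa [ha, (hpos a).1 ha] using h a b c
  have hdiv : ∀ a b, IsPos a → f a * f (b ^ 2 / a) = f b ^ 2 := by
    intro a b ha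
    rcases eq_or_ne b 0 with rfl | hb
    · simp [h0]
    have hfa := (hpos a).1 ha
    have he : IsPos (b ^ 2 / a) := by
      rw [div_eq_mul_inv]
      exact IsPos.mul ⟨b, hb, rfl⟩ ha.inv
    set e := b ^ 2 / a with hedef
    have : f e = f b ^ 2 / f a := by
      refine eq_of_isPos_sub_iff hF fun x => ?_
      obtain ⟨c, rfl⟩ := hsurj x
      have h1 := hsub a b c ha
      have h2 := hsub e e c he
      rw [show a * c - b ^ 2 = a * (c - e) by
        rw [hedef, mul_sub, mul_div_cancel₀ _ ha.ne_zero], ha.mul_iff,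
        show f a * f c - f b ^ 2 = f a * (f c - f b ^ 2 / f a) by
          rw [mul_sub, mul_div_cancel₀ _ hfa.ne_zero], hfa.mul_iff] at h1
      rw [show e * c - e ^ 2 = e * (c - e) by ring, he.mul_iff,
        show f e * f c - f e ^ 2 = f e * (f c - f e) by ring, ((hpos e).1 he).mul_iff] at h2
      rw [← h2, h1]
    rw [this, mul_div_cancel₀ _ hfa.ne_zero]
  have hsq : ∀ b, f (b ^ 2) = f b ^ 2 := by
    intro b
    simpa [h1] using hdiv 1 b isPos_one
  have hmulsq : ∀ a b, IsPos a → f (a * b ^ 2) = f a * f b ^ 2 := by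
    intro a b ha
    have e1 := hdiv a⁻¹ b ha.inv
    have e2 := hdiv a 1 ha
    rw [div_inv_eq_mul, mul_comm (b ^ 2)] at e1
    rw [one_pow, one_div, h1, one_pow] at e2
    calc f (a * b ^ 2) = (f a * f a⁻¹) * f (a * b ^ 2) := by rw [e2, one_mul]
      _ = f a * f b ^ 2 := by rw [mul_assoc, e1]
  have hmul : ∀ a x, IsPos a → f (a * x) = f a * f x := by
    intro a x ha
    rcases eq_or_ne x 0 with rfl | hx0
    · simp [h0]
    by_cases hx : IsPos x
    · obtain ⟨b, -, rfl⟩ := hx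
      rw [hmulsq a b ha, hsq]
    · have hfa := (hpos a).1 ha
      have hfx0 : f x ≠ 0 := fun h' => hx0 (hinj (h'.trans h0.symm))
      have hax : ¬ IsPos (a * x) := by rwa [ha.mul_iff]
      refine eq_of_isPos_sub_sq_iff hF ?_ (mul_ne_zero hfa.ne_zero hfx0) (by rwa [← hpos])
        (by rwa [hfa.mul_iff, ← hpos]) fun t => ?_
      · exact fun h' => mul_ne_zero ha.ne_zero hx0 (hinj (h'.trans h0.symm))
      · obtain ⟨b, rfl⟩ := hsurj t
        rw [← hone, ← hsub a b x ha]
  refine ⟨h0, fun x y => ?_⟩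
  rcases eq_or_ne x 0 with rfl | hx0
  · simp [h0]
  rcases eq_or_ne y 0 with rfl | hy0
  · simp [h0]
  by_cases hx : IsPos x
  · exact hmul x y hx
  by_cases hy : IsPos y
  · rw [mul_comm, hmul y x hy, mul_comm]
  have hr : IsPos (y / x) := by
    have := isPos_mul_of_not_isPos hF hx0 hy0 hx hy
    rwa [show x * y = x ^ 2 * (y / x) by field_simp, isPos_sq_mul_iff hx0] at this
  have hy' : y / x * x = y := div_mul_cancel₀ y hx0
  calc f (x * y) = f (y / x * x ^ 2) := by rw [sq, ← mul_assoc, hy', mul_comm]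
    _ = f (y / x * x) * f x := by rw [hmulsq _ _ hr, hmul _ _ hr]; ring
    _ = f x * f y := by rw [hy', mul_comm]

end Normalized

section Digits

/-- A binomial coefficient `choose n k` is not divisible by `p` when all base-`p` digits of `n`
are equal to `h` and those of `k` are at most `h`. -/
theorem not_dvd_choose_of_digits_le {p h : ℕ} (hp : p.Prime) (hh : h < p) (k : ℕ) (d : ℕ → ℕ)
    (hd : ∀ l, d l ≤ h) :
    ¬ p ∣ (h * ∑ l ∈ Finset.range k, p ^ l).choose (∑ l ∈ Finset.range k, d l * p ^ l) := by
  have := Fact.mk hp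
  induction k generalizing d with
  | zero => simpa using hp.one_lt.ne'
  | succ k ih =>
    have e1 : h * ∑ l ∈ Finset.range (k + 1), p ^ l =
        h + p * (h * ∑ l ∈ Finset.range k, p ^ l) := by
      rw [Finset.sum_range_succ']
      simp only [pow_succ, ← Finset.sum_mul]
      ring
    have e2 : ∑ l ∈ Finset.range (k + 1), d l * p ^ l =
        d 0 + p * ∑ l ∈ Finset.range k, d (l + 1) * p ^ l := by
      rw [Finset.sum_range_succ']
      simp only [pow_succ, ← mul_assoc, ← Finset.sum_mul]
      ring
    have hd0 : d 0 < p := (hd 0).trans_lt hh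
    rw [e1, e2, (Choose.choose_modEq_choose_mod_mul_choose_div_nat).dvd_iff dvd_rfl]
    simp only [Nat.add_mul_mod_self_left, Nat.add_mul_div_left _ _ hp.pos,
      Nat.mod_eq_of_lt hh, Nat.mod_eq_of_lt hd0, Nat.div_eq_of_lt hh, Nat.div_eq_of_lt hd0,
      zero_add]
    rw [hp.dvd_mul, not_or]
    refine ⟨fun hdvd => ?_, ih _ fun l => hd (l + 1)⟩
    have : p ∣ h.factorial := hdvd.trans
      ⟨(d 0).factorial * (h - d 0).factorial, by
        rw [← mul_assoc, Nat.choose_mul_factorial_mul_factorial (hd 0)]⟩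
    exact absurd ((hp.dvd_factorial).1 this) (not_le.2 hh)

/-- Suppose that every number `A` with at most `k` base-`p` digits, all at most `h`, satisfies
`A ≤ m` and `r * A % (2 * m) ≤ m`. Then reducing `r * A` modulo `2 * m` digit by digit gives a
number which is still at most `m`. -/
theorem sum_mul_mod_le {p h m k r : ℕ} (hp : 0 < p)
    (hdm : ∀ d : ℕ → ℕ, (∀ l, d l ≤ h) → ∑ l ∈ Finset.range k, d l * p ^ l ≤ m)
    (hcop : r.Coprime (2 * m))
    (hr : ∀ d : ℕ → ℕ, (∀ l, d l ≤ h) →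
      r * (∑ l ∈ Finset.range k, d l * p ^ l) % (2 * m) ≤ m)
    (d : ℕ → ℕ) (hd : ∀ l, d l ≤ h) :
    ∑ l ∈ Finset.range k, d l * (r * p ^ l % (2 * m)) ≤ m := by
  have hmod : ∀ d : ℕ → ℕ, ∑ l ∈ Finset.range k, d l * (r * p ^ l % (2 * m)) ≡
      r * (∑ l ∈ Finset.range k, d l * p ^ l) [MOD 2 * m] := by
    intro d
    rw [Finset.mul_sum]
    refine Nat.ModEq.sum fun l _ => ?_
    rw [mul_left_comm]
    exact (Nat.mod_modEq _ _).mul_left _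
  induction hn : ∑ l ∈ Finset.range k, d l generalizing d with
  | zero =>
    have : ∀ l ∈ Finset.range k, d l = 0 := Finset.sum_eq_zero_iff.1 hn
    rw [Finset.sum_eq_zero fun l hl => by rw [this l hl, zero_mul]]
    exact Nat.zero_le m
  | succ n ih =>
    obtain ⟨j, hj, hdj⟩ : ∃ j ∈ Finset.range k, 0 < d j := by
      by_contra! hcon
      have := Finset.sum_eq_zero fun l hl => Nat.le_zero.1 (hcon l hl)
      omega
    obtain ⟨d', rfl⟩ : ∃ d' : ℕ → ℕ, d = d' + Pi.single j 1 := by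
      refine ⟨fun l => d l - (Pi.single j 1 : ℕ → ℕ) l, ?_⟩
      ext l
      rcases eq_or_ne l j with rfl | hl
      · simp only [Pi.add_apply, Pi.single_eq_same]; omega
      · simp [hl]
    have hsplit : ∀ g : ℕ → ℕ, ∑ l ∈ Finset.range k, (d' + Pi.single j 1 : ℕ → ℕ) l * g l =
        ∑ l ∈ Finset.range k, d' l * g l + g j := by
      intro g
      have : ∑ l ∈ Finset.range k, (Pi.single j 1 : ℕ → ℕ) l * g l = g j := by
        rw [Finset.sum_eq_single_of_mem j hj fun l _ hl => by simp [hl]]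
        simp
      simp [add_mul, Finset.sum_add_distrib, ← this]
    have hd' : ∀ l, d' l ≤ h := fun l => le_trans (by simp) (hd l)
    have hih := ih d' hd' (by
      have := hsplit fun _ => 1
      simp only [mul_one] at this
      omega)
    have hsingle : r * p ^ j % (2 * m) ≤ m := by
      have h1 := hr (Pi.single j 1) fun l => le_trans (by simp) (hd l)
      rwa [Finset.sum_eq_single_of_mem j hj fun l _ hl => by simp [hl], Pi.single_eq_same,
        one_mul] at h1
    have hm1 := hmod (d' + Pi.single j 1)
    have hr1 := hr _ hd
    have hd1 := hdm _ hd
    set S := ∑ l ∈ Finset.range k, (d' + Pi.single j 1 : ℕ → ℕ) l * (r * p ^ l % (2 * m)) with hS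
    set A := ∑ l ∈ Finset.range k, (d' + Pi.single j 1 : ℕ → ℕ) l * p ^ l with hA
    have hA0 : 0 < A := by
      rw [hA, hsplit]
      have := pow_pos hp j
      omega
    have hS2 : S ≤ 2 * m := by
      rw [hS, hsplit]
      omega
    rcases hS2.lt_or_eq with hlt | heq
    · rw [← hm1, Nat.mod_eq_of_lt hlt] at hr1
      exact hr1
    · exfalso
      have hdvd : 2 * m ∣ r * A := (hm1.dvd_iff dvd_rfl).1 (dvd_of_eq heq.symm)
      have := Nat.le_of_dvd hA0 (hcop.symm.dvd_of_dvd_mul_left hdvd)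
      omega

/-- If the residues of `r`, `r * p`, …, `r * p ^ (k - 1)` modulo `p ^ k - 1` are as small as
possible on average, then `r` is a power of `p` modulo `p ^ k - 1`. -/
theorem exists_mod_eq_pow {p k r Q : ℕ} (hQ0 : 0 < Q) (hQ : Q + 1 = p ^ k)
    (hr : r % Q ≠ 0)
    (hsum : (p - 1) * ∑ l ∈ Finset.range k, r * p ^ l % Q ≤ Q) :
    ∃ ℓ, ℓ ≤ k - 1 ∧ r % Q = p ^ ℓ := by
  let d : ℕ → ℕ := fun l => p * (r * p ^ l % Q) / Q
  have hstep : ∀ l, p * (r * p ^ l % Q) = r * p ^ (l + 1) % Q + Q * d l := by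
    intro l
    have : r * p ^ (l + 1) % Q = p * (r * p ^ l % Q) % Q := by
      rw [Nat.mul_mod_mod]; congr 1; ring
    rw [this]
    exact (Nat.mod_add_div _ _).symm
  have hcyc : r * p ^ k % Q = r % Q := by
    rw [← hQ, mul_add, mul_one, Nat.mul_add_mod_self_right]
  have hclosed : ∀ n, r * p ^ n % Q + Q * ∑ l ∈ Finset.range n, d l * p ^ (n - 1 - l) =
      p ^ n * (r % Q) := by
    intro n
    induction n with
    | zero => simp
    | succ n ih =>
      have e : ∑ l ∈ Finset.range n, d l * p ^ (n + 1 - 1 - l) =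
          p * ∑ l ∈ Finset.range n, d l * p ^ (n - 1 - l) := by
        rw [Finset.mul_sum]
        refine Finset.sum_congr rfl fun l hl => ?_
        have hl := Finset.mem_range.1 hl
        rw [show n + 1 - 1 - l = n - 1 - l + 1 by omega, pow_succ]
        ring
      rw [Finset.sum_range_succ, e, pow_succ, mul_comm (p ^ n) p, mul_assoc, ← ih, mul_add p,
        hstep n]
      simp only [Nat.add_sub_cancel, Nat.sub_self, pow_zero]
      ring_nf
  have hrsum : r % Q = ∑ l ∈ Finset.range k, d l * p ^ (k - 1 - l) := by
    have h1 := hclosed k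
    rw [hcyc, ← hQ, add_mul, one_mul, add_comm] at h1
    exact (Nat.eq_of_mul_eq_mul_left hQ0 (Nat.add_right_cancel h1)).symm
  have hdsum : ∑ l ∈ Finset.range k, d l ≤ 1 := by
    have h1 : ∑ l ∈ Finset.range k, r * p ^ (l + 1) % Q = ∑ l ∈ Finset.range k, r * p ^ l % Q := by
      have := Finset.sum_range_succ (fun l => r * p ^ l % Q) k
      rw [Finset.sum_range_succ', hcyc] at this
      simpa using this
    have h2 : p * ∑ l ∈ Finset.range k, r * p ^ l % Q =
        ∑ l ∈ Finset.range k, r * p ^ l % Q + Q * ∑ l ∈ Finset.range k, d l := by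
      rw [Finset.mul_sum, Finset.sum_congr rfl fun l _ => hstep l, Finset.sum_add_distrib, h1,
        Finset.mul_sum]
    rw [Nat.sub_mul, h2, one_mul, Nat.add_sub_cancel_left] at hsum
    exact Nat.le_of_mul_le_mul_left (by simpa using hsum) hQ0
  obtain ⟨j, hj, hdj⟩ : ∃ j ∈ Finset.range k, d j ≠ 0 := by
    by_contra! hcon
    exact hr (hrsum.trans (Finset.sum_eq_zero fun l hl => by rw [hcon l hl, zero_mul]))
  rw [← Finset.add_sum_erase _ _ hj] at hdsum
  have hd0 : ∀ l ∈ (Finset.range k).erase j, d l = 0 :=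
    Finset.sum_eq_zero_iff.1 (by omega)
  refine ⟨k - 1 - j, Nat.sub_le _ _, ?_⟩
  rw [hrsum, ← Finset.add_sum_erase _ _ hj,
    Finset.sum_eq_zero fun l hl => by rw [hd0 l hl, zero_mul], show d j = 1 by omega]
  simp

end Digits

section PowerMaps

variable {F : Type*} [Field F] [Fintype F]

theorem sum_units_pow_mul_pow_sub_one [DecidableEq F] (E r m : ℕ) :
    ∑ u : Fˣ, (u : F) ^ E * ((u : F) ^ r - 1) ^ m =
      ∑ i ∈ Finset.range (m + 1), (-1) ^ (m - i) * (m.choose i : F) *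
        if Fintype.card F - 1 ∣ E + r * i then -1 else 0 := by
  simp only [← FiniteField.sum_pow_units F, Finset.mul_sum]
  rw [Finset.sum_comm]
  refine Finset.sum_congr rfl fun u _ => ?_
  rw [sub_eq_add_neg, add_pow, Finset.mul_sum]
  refine Finset.sum_congr rfl fun i _ => ?_
  rw [pow_add, pow_mul]
  ring

/-- If `x ↦ x ^ r` preserves the quadratic character of `x - 1`, then multiplication by `r`
modulo `#F - 1` maps the support of the binomial expansion of `(X - 1) ^ (#F / 2)` into
`{0, …, #F / 2}`. -/
theorem mul_mod_le_of_pow_eq {p m r i : ℕ} [CharP F p] (hm0 : 0 < m)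
    (hm : Fintype.card F = 2 * m + 1) (hcop : r.Coprime (2 * m))
    (hpow : ∀ u : Fˣ, ((u : F) ^ r - 1) ^ m = ((u : F) - 1) ^ m) (hi : i ≤ m)
    (hpi : ¬ p ∣ m.choose i) : r * i % (2 * m) ≤ m := by
  classical
  by_contra! hlt
  have hQ : Fintype.card F - 1 = 2 * m := by omega
  set e := r * i % (2 * m) with he
  have he' : e < 2 * m := Nat.mod_lt _ (by omega)
  have h1 := sum_units_pow_mul_pow_sub_one (F := F) (2 * m - e) 1 m
  have h2 := sum_units_pow_mul_pow_sub_one (F := F) (2 * m - e) r m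
  rw [hQ] at h1 h2
  rw [Finset.sum_eq_zero (s := Finset.range (m + 1))] at h1
  · have hiff : ∀ j ∈ Finset.range (m + 1), j ≠ i → ¬ 2 * m ∣ 2 * m - e + r * j := by
      intro j hj hji hdvd
      have hj := Finset.mem_range.1 hj
      have c1 : 2 * m - e + r * j ≡ 2 * m - e + r * i [MOD 2 * m] := by
        have c2 : 2 * m - e + r * i ≡ 2 * m - e + e [MOD 2 * m] :=
          Nat.ModEq.add_left _ (Nat.mod_modEq _ _).symm
        rw [Nat.sub_add_cancel he'.le] at c2
        refine ((Nat.modEq_zero_iff_dvd.2 hdvd).trans ?_).trans c2.symm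
        exact (Nat.modEq_zero_iff_dvd.2 dvd_rfl).symm
      have c3 : j ≡ i [MOD 2 * m] :=
        Nat.ModEq.cancel_left_of_coprime hcop.symm (Nat.ModEq.add_left_cancel' _ c1)
      exact hji (c3.eq_of_lt_of_lt (by omega) (by omega))
    have hdvd : 2 * m ∣ 2 * m - e + r * i := by
      refine ⟨1 + r * i / (2 * m), ?_⟩
      have := Nat.mod_add_div (r * i) (2 * m)
      rw [← he] at this
      rw [mul_add, mul_one]
      omega
    rw [Finset.sum_eq_single_of_mem i (Finset.mem_range.2 (by omega))
      (fun j hj hji => by rw [if_neg (hiff j hj hji), mul_zero]), if_pos hdvd] at h2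
    simp only [hpow, pow_one] at h1 h2
    rw [h1] at h2
    have hne : (m.choose i : F) ≠ 0 := by rwa [Ne, CharP.cast_eq_zero_iff F p]
    exact absurd h2.symm (by simp [hne])
  · intro j hj
    have hj := Finset.mem_range.1 hj
    rw [if_neg, mul_zero]
    intro hdvd
    have := Nat.eq_of_dvd_of_lt_two_mul (by omega) hdvd (by omega)
    omega

/-- An injective multiplicative map of a finite field of odd order which preserves the quadratic
character of `x - 1` is a power of the Frobenius. -/
theorem exists_eq_pow_of_map_mul {p k : ℕ} (hp : p.Prime) (hodd : Odd p) (hk : 1 ≤ k)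
    (hcard : Fintype.card F = p ^ k) {f : F → F} (hinj : Function.Injective f) (h0 : f 0 = 0)
    (hmul : ∀ x y, f (x * y) = f x * f y)
    (hpow : ∀ x, (f x - 1) ^ (Fintype.card F / 2) = (x - 1) ^ (Fintype.card F / 2)) :
    ∃ ℓ, ℓ ≤ k - 1 ∧ ∀ x, f x = x ^ p ^ ℓ := by
  classical
  have := Fact.mk hp
  have : CharP F p := charP_of_card_eq_prime_pow hcard
  have h1 : f 1 = 1 := by
    have hne : f 1 ≠ 0 := fun h => one_ne_zero (hinj (h.trans h0.symm))
    have := hmul 1 1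
    rw [mul_one] at this
    exact (mul_eq_left₀ hne).1 this.symm
  let φ : F →* F := { toFun := f, map_one' := h1, map_mul' := hmul }
  obtain ⟨h, rfl⟩ := hodd
  have hh0 : 0 < h := by
    rcases Nat.eq_zero_or_pos h with rfl | hh
    · exact absurd hp (by norm_num)
    · exact hh
  set p := 2 * h + 1 with hpdef
  set m := h * ∑ l ∈ Finset.range k, p ^ l with hm
  have hgeom : 2 * m + 1 = p ^ k := by
    rw [hm, ← mul_assoc, hpdef, ← geom_sum_mul_add (2 * h) k, mul_comm]
  have hm0 : 0 < m := by
    have := Nat.one_lt_pow (by omega : k ≠ 0) hp.one_lt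
    omega
  have hcard' : Fintype.card F = 2 * m + 1 := hcard.trans hgeom.symm
  have hQ : Fintype.card F - 1 = 2 * m := by omega
  have hhalf : Fintype.card F / 2 = m := by omega
  obtain ⟨g, hg⟩ := IsCyclic.exists_generator (α := Fˣ)
  have hord : orderOf g = 2 * m := by
    rw [orderOf_eq_card_of_forall_mem_zpowers hg, Nat.card_eq_fintype_card, Fintype.card_units, hQ]
  obtain ⟨r, hr⟩ : ∃ r : ℕ, g ^ r = Units.map φ g :=
    (mem_powers_iff_mem_zpowers.2 (hg (Units.map φ g)))
  have hfu : ∀ u : Fˣ, f u = (u : F) ^ r := by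
    intro u
    obtain ⟨n, rfl⟩ := mem_powers_iff_mem_zpowers.2 (hg u)
    have : Units.map φ (g ^ n) = (g ^ n) ^ r := by
      rw [map_pow, ← hr, ← pow_mul, ← pow_mul, mul_comm]
    rw [← Units.val_pow_eq_pow_val, ← this]
    rfl
  have hcop : r.Coprime (2 * m) := by
    have hφ : Function.Injective (Units.map φ) := Units.map_injective hinj
    have h2 := orderOf_injective (Units.map φ) hφ g
    rw [← hr, orderOf_pow, hord, Nat.div_eq_self] at h2
    rw [Nat.coprime_comm]
    exact h2.resolve_left (by omega)
  have hI : ∀ d : ℕ → ℕ, (∀ l, d l ≤ h) → ∑ l ∈ Finset.range k, d l * p ^ l ≤ m := by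
    intro d hd
    rw [hm, Finset.mul_sum]
    exact Finset.sum_le_sum fun l _ => Nat.mul_le_mul_right _ (hd l)
  have hsum := sum_mul_mod_le hp.pos hI hcop (fun d hd => by
    refine mul_mod_le_of_pow_eq (F := F) (p := p) hm0 hcard' hcop (fun u => ?_) (hI d hd)
      (not_dvd_choose_of_digits_le hp (by omega) k d hd)
    rw [← hfu, ← hhalf, hpow]) (fun _ => h) fun _ => le_rfl
  have hr0 : r % (2 * m) ≠ 0 := by
    intro hzero
    have := Nat.eq_one_of_dvd_coprimes hcop (Nat.dvd_of_mod_eq_zero hzero) dvd_rfl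
    omega
  obtain ⟨ℓ, hℓ, hrℓ⟩ := exists_mod_eq_pow (p := p) (k := k) (by omega) hgeom hr0 (by
    rw [← Finset.mul_sum] at hsum
    rw [show p - 1 = 2 * h by omega, mul_assoc]
    omega)
  refine ⟨ℓ, hℓ, fun x => ?_⟩
  rcases eq_or_ne x 0 with rfl | hx
  · rw [h0, zero_pow (pow_ne_zero _ hp.ne_zero)]
  · have := hfu (Units.mk0 x hx)
    rw [Units.val_mk0] at this
    rw [this, ← hrℓ, ← Nat.mod_add_div r (2 * m), pow_add, pow_mul, ← hQ,
      FiniteField.pow_card_sub_one_eq_one x hx, one_pow, mul_one, Nat.mod_add_div]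

end PowerMaps

/-- over `F = 𝔽_{p^k}` with `p` odd, `f` is a sign preserver on `M_2(F)`
iff `f` is a positive multiple of a field automorphism of `F`. -/
theorem stmt7 {F : Type*} [Field F] [Fintype F] (p k : ℕ) (hp : p.Prime) (hodd : Odd p)
    (hk : 1 ≤ k) (hcard : Fintype.card F = p ^ k) (f : F → F) :
    SignPreserver 2 f ↔
      ∃ (c : F) (ℓ : ℕ), IsPos c ∧ ℓ ≤ k - 1 ∧ ∀ x : F, f x = c * x ^ p ^ ℓ := by
  have := Fact.mk hp
  have hchar : CharP F p := charP_of_card_eq_prime_pow hcard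
  constructor
  · intro hf
    rw [signPreserver_two_iff] at hf
    have hF : ringChar F ≠ 2 := by
      rw [ringChar.eq F p]
      rintro rfl
      exact absurd hodd (by decide)
    have hc : IsPos (f 1) := ((hf 1 0 1).1 (by simp [isPos_one])).1
    set c := f 1 with hcdef
    let g : F → F := fun x => f x / c
    have hfg : ∀ x, f x = c * g x := fun x => (mul_div_cancel₀ _ hc.ne_zero).symm
    have hg1 : g 1 = 1 := div_self hc.ne_zero
    have hg : ∀ a b d : F, (IsPos a ∧ IsPos (a * d - b ^ 2)) ↔
        (IsPos (g a) ∧ IsPos (g a * g d - g b ^ 2)) := by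
      intro a b d
      rw [hf, hfg a, hfg b, hfg d, hc.mul_iff,
        show c * g a * (c * g d) - (c * g b) ^ 2 = c ^ 2 * (g a * g d - g b ^ 2) by ring,
        isPos_sq_mul_iff hc.ne_zero]
    have hinj := injective_of_isPos_iff hF hg1 hg
    obtain ⟨h0, hmul⟩ := map_mul_of_isPos_iff hF hg1 hg
    obtain ⟨ℓ, hℓ, hgℓ⟩ := exists_eq_pow_of_map_mul hp hodd hk hcard hinj h0 hmul fun x =>
      pow_eq_pow_of_isPos_iff hF
        (by rw [sub_eq_zero, sub_eq_zero, ← hg1, hinj.eq_iff, hg1])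
        (by simpa [hg1, isPos_one] using (hg 1 1 x).symm)
    exact ⟨c, ℓ, hc, hℓ, fun x => by rw [hfg, hgℓ]⟩
  · rintro ⟨c, ℓ, hc, -, hf⟩
    obtain rfl : f = fun x => c * iterateFrobeniusEquiv F p ℓ x := funext hf
    exact signPreserver_two_mul_map hc _
end

section
/- Let F_q be a finite field with q ≡ 3 (mod 4). Suppose f : F_q → F_q preserves positivity on M_2(F_q) and f(1) = 1. Then f(−x) = −f(x) for all x ∈ F_q, and f(x^2) = f(x)^2 for all x ∈ F_q. -/
theorem exists_sq_add_sq_eq {F : Type*} [Field F] [Fintype F] (hF : Fintype.card F % 2 = 1)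
    (x : F) : ∃ a b : F, a ^ 2 + b ^ 2 = x := by
  obtain ⟨a, b, hab⟩ := FiniteField.exists_root_sum_quadratic
    (Polynomial.degree_X_pow 2) (Polynomial.degree_X_pow_sub_C two_pos x) hF
  refine ⟨a, b, ?_⟩
  rw [← sub_eq_zero]
  simpa only [Polynomial.eval_C, Polynomial.eval_X, Polynomial.eval_pow, Polynomial.eval_sub,
    ← add_sub_assoc] using hab

namespace IsPos

variable {F : Type*} [Field F] {x y : F}

theorem ne_zero_s15 (hx : IsPos x) : x ≠ 0 := by
  obtain ⟨y, hy, rfl⟩ := hx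
  exact pow_ne_zero 2 hy

theorem not_zero : ¬ IsPos (0 : F) := fun h => h.ne_zero_s15 rfl

theorem one : IsPos (1 : F) := ⟨1, one_ne_zero, one_pow 2⟩

theorem sq_of_ne_zero (hx : x ≠ 0) : IsPos (x ^ 2) := ⟨x, hx, rfl⟩

theorem mul_s15 (hx : IsPos x) (hy : IsPos y) : IsPos (x * y) := by
  obtain ⟨a, ha, rfl⟩ := hx
  obtain ⟨b, hb, rfl⟩ := hy
  exact ⟨a * b, mul_ne_zero ha hb, mul_pow a b 2⟩

theorem inv_s15 (hx : IsPos x) : IsPos x⁻¹ := by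
  obtain ⟨a, ha, rfl⟩ := hx
  exact ⟨a⁻¹, inv_ne_zero ha, inv_pow a 2⟩

theorem div (hx : IsPos x) (hy : IsPos y) : IsPos (x / y) := by
  rw [div_eq_mul_inv]
  exact hx.mul_s15 hy.inv_s15

variable [Fintype F]

theorem not_neg (hq : Fintype.card F % 4 = 3) (hx : IsPos x) : ¬ IsPos (-x) := by
  intro h
  obtain ⟨y, -, hy⟩ := h.div hx
  refine FiniteField.isSquare_neg_one_iff.mp ⟨y, ?_⟩ hq
  rw [← sq, hy, neg_div, div_self hx.ne_zero_s15]

theorem or_neg (hq : Fintype.card F % 4 = 3) (hx : x ≠ 0) : IsPos x ∨ IsPos (-x) := by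
  have hF : ringChar F ≠ 2 := by
    intro h
    have := FiniteField.even_card_of_char_two h
    omega
  have key : ∀ z : F, z ≠ 0 → z ^ (Fintype.card F / 2) = 1 → IsPos z := by
    intro z hz h
    obtain ⟨y, rfl⟩ := (FiniteField.isSquare_iff hF hz).mpr h
    exact ⟨y, left_ne_zero_of_mul hz, sq y⟩
  have hodd : Odd (Fintype.card F / 2) := by
    rw [Nat.odd_iff]
    omega
  rcases FiniteField.pow_dichotomy hF hx with h | h
  · exact .inl (key x hx h)
  · exact .inr (key (-x) (neg_ne_zero.mpr hx) (by rw [hodd.neg_pow, h, neg_neg]))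

theorem sub_or_sub (hq : Fintype.card F % 4 = 3) (h : x ≠ y) :
    IsPos (x - y) ∨ IsPos (y - x) := by
  simpa using or_neg hq (sub_ne_zero.mpr h)

theorem exists_pos_sqrt (hq : Fintype.card F % 4 = 3) (hx : IsPos x) :
    ∃ y, IsPos y ∧ y ^ 2 = x := by
  obtain ⟨y, hy, rfl⟩ := hx
  rcases or_neg hq hy with h | h
  · exact ⟨y, h, rfl⟩
  · exact ⟨-y, h, neg_sq y⟩

theorem eq_of_sq_eq (hq : Fintype.card F % 4 = 3) (hx : IsPos x) (hy : IsPos y)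
    (h : x ^ 2 = y ^ 2) : x = y := by
  rcases sq_eq_sq_iff_eq_or_eq_neg.mp h with h | h
  · exact h
  · exact absurd (h ▸ hx) (hy.not_neg hq)

theorem exists_sub_sq_pos_of_neg (hq : Fintype.card F % 4 = 3) (hx : IsPos x) :
    ∃ y, IsPos y ∧ IsPos (-x - y ^ 2) := by
  obtain ⟨a, b, hab⟩ := exists_sq_add_sq_eq (by omega) (-x)
  have ne : ∀ a b : F, a ^ 2 + b ^ 2 = -x → b ≠ 0 := by
    rintro a b hab rfl
    refine hx.not_neg hq ⟨a, ?_, by simpa using hab⟩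
    rintro rfl
    exact hx.ne_zero_s15 (by simpa using hab.symm)
  obtain ⟨y, hy, hya⟩ :=
    exists_pos_sqrt hq (sq_of_ne_zero (ne b a (by rw [add_comm, hab])))
  refine ⟨y, hy, b, ne a b hab, ?_⟩
  rw [hya, ← hab]
  ring

/-- Distinct positive elements of a finite field have incomparable sets of positive elements
exceeding them by a positive element. -/
theorem eq_of_forall_sub (hq : Fintype.card F % 4 = 3) (hx : IsPos x) (hy : IsPos y)
    (h : ∀ z, IsPos z → IsPos (z - x) → IsPos (z - y)) : x = y := by
  by_contra hne
  rcases sub_or_sub hq hne with hxy | hyx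
  · have hx0 := hx.ne_zero_s15
    have hy0 := hy.ne_zero_s15
    have hn : IsPos (x / y) := hx.div hy
    have iter : ∀ k : ℕ, IsPos ((x / y) ^ (k + 1)) ∧ IsPos ((x / y) ^ (k + 1) - 1) := by
      intro k
      induction k with
      | zero =>
        refine ⟨by simpa using hn, ?_⟩
        convert hxy.div hy using 1
        rw [zero_add, pow_one, sub_div, div_self hy0]
      | succ k ih =>
        refine ⟨by rw [pow_succ]; exact ih.1.mul_s15 hn, ?_⟩
        have := h (x * (x / y) ^ (k + 1)) (hx.mul_s15 ih.1) (by
          convert hx.mul_s15 ih.2 using 1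
          ring)
        convert this.div hy using 1
        rw [pow_succ _ (k + 1), sub_div, div_self hy0]
        ring
    have hcard : 1 < Fintype.card F := Fintype.one_lt_card
    have := (iter (Fintype.card F - 2)).2
    rw [show Fintype.card F - 2 + 1 = Fintype.card F - 1 by omega,
      FiniteField.pow_card_sub_one_eq_one _ hn.ne_zero_s15, sub_self] at this
    exact not_zero this
  · exact not_zero (by simpa using h y hy hyx)

end IsPos

theorem isPosDef_two_iff_s15 {F : Type*} [Field F] (a b c : F) :
    IsPosDef !![a, b; b, c] ↔ IsPos a ∧ IsPos (a * c - b ^ 2) := by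
  have hsymm : (!![a, b; b, c] : Matrix (Fin 2) (Fin 2) F).IsSymm := by
    ext i j
    fin_cases i <;> fin_cases j <;> rfl
  have h0 : leadingMinor !![a, b; b, c] 0 = a := by
    simp only [leadingMinor]
    exact Matrix.det_fin_one _
  have h1 : leadingMinor !![a, b; b, c] 1 = a * c - b ^ 2 := by
    simp only [leadingMinor]
    refine (Matrix.det_fin_two _).trans ?_
    rw [sq]
    rfl
  simp only [IsPosDef, hsymm, true_and, Fin.forall_fin_two, h0, h1]

namespace PreservesPos

variable {F : Type*} [Field F] {f : F → F}

theorem map_minor (hf : PreservesPos 2 f) {a b c : F} (ha : IsPos a)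
    (h : IsPos (a * c - b ^ 2)) : IsPos (f a) ∧ IsPos (f a * f c - f b ^ 2) := by
  have := hf _ ((isPosDef_two_iff_s15 a b c).mpr ⟨ha, h⟩)
  rwa [show entrywiseMap f !![a, b; b, c] = !![f a, f b; f b, f c] by
    ext i j
    fin_cases i <;> fin_cases j <;> rfl, isPosDef_two_iff_s15] at this

theorem map_pos (hf : PreservesPos 2 f) {a : F} (ha : IsPos a) : IsPos (f a) :=
  (hf.map_minor (b := 0) (c := a) ha (by simpa using ha.mul_s15 ha)).1

variable [Fintype F]

theorem injOn_pos (hq : Fintype.card F % 4 = 3) (hf : PreservesPos 2 f) {a b : F}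
    (ha : IsPos a) (hb : IsPos b) (h : f a = f b) : a = b := by
  by_contra hne
  have hne2 : a ^ 2 ≠ b ^ 2 := fun h => hne (ha.eq_of_sq_eq hq hb h)
  rcases IsPos.sub_or_sub hq hne2 with h2 | h2
  · have := (hf.map_minor (b := b) (c := a) ha (by rwa [← sq])).2
    rw [h, sq, sub_self] at this
    exact IsPos.not_zero this
  · have := (hf.map_minor (b := a) (c := b) hb (by rwa [← sq])).2
    rw [h, sq, sub_self] at this
    exact IsPos.not_zero this

theorem exists_pos_map_eq (hq : Fintype.card F % 4 = 3) (hf : PreservesPos 2 f) {y : F}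
    (hy : IsPos y) : ∃ x, IsPos x ∧ f x = y := by
  let g : {x : F // IsPos x} → {x : F // IsPos x} := fun x => ⟨f x, hf.map_pos x.2⟩
  have hg : Function.Injective g := fun a b h =>
    Subtype.ext (hf.injOn_pos hq a.2 b.2 (congrArg Subtype.val h))
  obtain ⟨x, hx⟩ := (Finite.injective_iff_surjective.mp hg) ⟨y, hy⟩
  exact ⟨x, x.2, congrArg Subtype.val hx⟩

theorem map_minor_iff (hq : Fintype.card F % 4 = 3) (hf : PreservesPos 2 f) {a b c : F}
    (ha : IsPos a) (hb : IsPos b) (hc : IsPos c) :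
    IsPos (f a * f c - f b ^ 2) ↔ IsPos (a * c - b ^ 2) := by
  refine ⟨fun h => ?_, fun h => (hf.map_minor ha h).2⟩
  let T := {t : F × F × F //
    (IsPos t.1 ∧ IsPos t.2.1 ∧ IsPos t.2.2) ∧ IsPos (t.1 * t.2.2 - t.2.1 ^ 2)}
  let g : T → T := fun t => ⟨(f t.1.1, f t.1.2.1, f t.1.2.2),
    ⟨hf.map_pos t.2.1.1, hf.map_pos t.2.1.2.1, hf.map_pos t.2.1.2.2⟩,
    (hf.map_minor t.2.1.1 t.2.2).2⟩
  have hg : Function.Injective g := by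
    rintro ⟨⟨a, b, c⟩, ⟨ha, hb, hc⟩, h⟩ ⟨⟨a', b', c'⟩, ⟨ha', hb', hc'⟩, h'⟩ heq
    replace heq := congrArg Subtype.val heq
    simp only [g, Prod.mk.injEq] at heq
    exact Subtype.ext (Prod.ext (hf.injOn_pos hq ha ha' heq.1)
      (Prod.ext (hf.injOn_pos hq hb hb' heq.2.1) (hf.injOn_pos hq hc hc' heq.2.2)))
  obtain ⟨⟨⟨a', b', c'⟩, ⟨ha', hb', hc'⟩, h'⟩, heq⟩ :=
    (Finite.injective_iff_surjective.mp hg)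
      ⟨(f a, f b, f c), ⟨hf.map_pos ha, hf.map_pos hb, hf.map_pos hc⟩, h⟩
  replace heq := congrArg Subtype.val heq
  simp only [g, Prod.mk.injEq] at heq
  rwa [← hf.injOn_pos hq ha' ha heq.1, ← hf.injOn_pos hq hb' hb heq.2.1,
    ← hf.injOn_pos hq hc' hc heq.2.2]

theorem exists_pos_map_sq_eq (hq : Fintype.card F % 4 = 3) (hf : PreservesPos 2 f) {y : F}
    (hy : IsPos y) : ∃ x, IsPos x ∧ f x ^ 2 = y := by
  obtain ⟨r, hr, rfl⟩ := hy.exists_pos_sqrt hq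
  obtain ⟨x, hx, rfl⟩ := hf.exists_pos_map_eq hq hr
  exact ⟨x, hx, rfl⟩

theorem map_mul_map_congr (hq : Fintype.card F % 4 = 3) (hf : PreservesPos 2 f)
    {a c a' c' : F} (ha : IsPos a) (hc : IsPos c) (ha' : IsPos a') (hc' : IsPos c')
    (h : a * c = a' * c') : f a * f c = f a' * f c' := by
  have key : ∀ b, IsPos b →
      (IsPos (f a * f c - f b ^ 2) ↔ IsPos (f a' * f c' - f b ^ 2)) := fun b hb => by
    rw [hf.map_minor_iff hq ha hb hc, hf.map_minor_iff hq ha' hb hc', h]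
  by_contra hne
  rcases IsPos.sub_or_sub hq hne with hp | hp
  · obtain ⟨b, hb, hbe⟩ := hf.exists_pos_map_sq_eq hq ((hf.map_pos ha').mul_s15 (hf.map_pos hc'))
    have := (key b hb).mp (by rwa [hbe])
    rw [hbe, sub_self] at this
    exact IsPos.not_zero this
  · obtain ⟨b, hb, hbe⟩ := hf.exists_pos_map_sq_eq hq ((hf.map_pos ha).mul_s15 (hf.map_pos hc))
    have := (key b hb).mpr (by rwa [hbe])
    rw [hbe, sub_self] at this
    exact IsPos.not_zero this

theorem map_zero (hq : Fintype.card F % 4 = 3) (hf : PreservesPos 2 f) : f 0 = 0 := by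
  by_contra h0
  obtain ⟨a, ha, hae⟩ := hf.exists_pos_map_sq_eq hq (IsPos.sq_of_ne_zero h0)
  have := (hf.map_minor (b := 0) (c := a) ha (by simpa using ha.mul_s15 ha)).2
  rw [← sq, hae, sub_self] at this
  exact IsPos.not_zero this

theorem map_neg_ne_zero (hq : Fintype.card F % 4 = 3) (hf : PreservesPos 2 f) {u : F}
    (hu : IsPos u) : f (-u) ≠ 0 := by
  intro h0
  obtain ⟨e, he, hue⟩ := hu.exists_sub_sq_pos_of_neg hq
  have := (hf.map_minor (b := e) (c := -u) IsPos.one (by rwa [one_mul])).2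
  rw [h0, mul_zero, zero_sub] at this
  exact (IsPos.sq_of_ne_zero (hf.map_pos he).ne_zero_s15).not_neg hq this

theorem map_neg_sq (hq : Fintype.card F % 4 = 3) (hf : PreservesPos 2 f) {u : F}
    (hu : IsPos u) : f (-u) ^ 2 = f u ^ 2 := by
  obtain ⟨w, hw, hwe⟩ :=
    hf.exists_pos_map_sq_eq hq (IsPos.sq_of_ne_zero (hf.map_neg_ne_zero hq hu))
  have huw : u ^ 2 = w ^ 2 := by
    refine IsPos.eq_of_forall_sub hq (IsPos.sq_of_ne_zero hu.ne_zero_s15)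
      (IsPos.sq_of_ne_zero hw.ne_zero_s15) fun z hz h => ?_
    have := (hf.map_minor (b := -u) (c := z) IsPos.one (by rwa [one_mul, neg_sq])).2
    rw [← hwe, hf.map_minor_iff hq IsPos.one hw hz, one_mul] at this
    exact this
  rw [← hwe, hu.eq_of_sq_eq hq hw huw]

theorem map_neg_of_pos (hq : Fintype.card F % 4 = 3) (hf : PreservesPos 2 f) {u : F}
    (hu : IsPos u) : f (-u) = -f u := by
  refine (sq_eq_sq_iff_eq_or_eq_neg.mp (hf.map_neg_sq hq hu)).resolve_left fun heq => ?_
  have key : ∀ e, IsPos e → IsPos (-u - e ^ 2) → IsPos (u - e ^ 2) := fun e he h => by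
    have := (hf.map_minor (b := e) (c := -u) IsPos.one (by rwa [one_mul])).2
    rwa [heq, hf.map_minor_iff hq IsPos.one he hu, one_mul] at this
  obtain ⟨e, he, hue⟩ := hu.exists_sub_sq_pos_of_neg hq
  have he0 := he.ne_zero_s15
  have hk : IsPos (u / e ^ 2) := hu.div (IsPos.sq_of_ne_zero he0)
  have h1 := key (u / e) (hu.div he) (by
    convert hk.mul_s15 hue using 1
    field_simp
    ring)
  refine (key e he hue).not_neg hq ?_
  convert h1.div hk using 1
  have := hu.ne_zero_s15
  field_simp
  ring

theorem map_neg (hq : Fintype.card F % 4 = 3) (hf : PreservesPos 2 f) (x : F) :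
    f (-x) = -f x := by
  rcases eq_or_ne x 0 with rfl | hx
  · simp [hf.map_zero hq]
  rcases IsPos.or_neg hq hx with h | h
  · exact hf.map_neg_of_pos hq h
  · rw [← neg_neg (f (-x)), ← hf.map_neg_of_pos hq h, neg_neg]

theorem map_sq_of_pos (hq : Fintype.card F % 4 = 3) (hf : PreservesPos 2 f) (hf1 : f 1 = 1)
    {x : F} (hx : IsPos x) : f (x ^ 2) = f x ^ 2 := by
  have := hf.map_mul_map_congr hq hx hx IsPos.one (hx.mul_s15 hx) (one_mul _).symm
  rw [hf1, one_mul] at this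
  rw [sq, sq, this]

theorem map_sq (hq : Fintype.card F % 4 = 3) (hf : PreservesPos 2 f) (hf1 : f 1 = 1)
    (x : F) : f (x ^ 2) = f x ^ 2 := by
  rcases eq_or_ne x 0 with rfl | hx
  · simp [hf.map_zero hq]
  rcases IsPos.or_neg hq hx with h | h
  · exact hf.map_sq_of_pos hq hf1 h
  · rw [← neg_sq x, hf.map_sq_of_pos hq hf1 h, hf.map_neg hq, neg_sq]

end PreservesPos

/-- if `q ≡ 3 (mod 4)`, `f` preserves positivity on `M_2(F_q)` and
`f 1 = 1`, then `f (−x) = −f x` and `f (x²) = (f x)²` for all `x`. -/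
theorem stmt15 {F : Type*} [Field F] [Fintype F] (hq : Fintype.card F % 4 = 3)
    (f : F → F) (hpres : PreservesPos 2 f) (hf1 : f 1 = 1) :
    (∀ x : F, f (-x) = - f x) ∧ (∀ x : F, f (x ^ 2) = (f x) ^ 2) :=
  ⟨hpres.map_neg hq, hpres.map_sq hq hf1⟩
end
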